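/- (Theorem A, part 1) For any simple 𝔤₀-supermodule V, the Kac module K(V) has a unique simple top L(V), and the correspondence V ↦ L(V) induces a bijection between the set of isomorphism classes of simple 𝔤₀̄-supermodules and the set of isomorphism classes of simple 𝔤-supermodules. -/

import Mathlib

noncomputable section

open Module Function

/-- A complex Lie superalgebra `𝔤 = 𝔤₀̄ ⊕ 𝔤₁̄` equipped with a compatible `ℤ`-grading
`𝔤 = 𝔤₋₁ ⊕ 𝔤₀ ⊕ 𝔤₁`, i.e. `𝔤₀ = 𝔤₀̄`, `𝔤₁̄ = 𝔤₁ ⊕ 𝔤₋₁`, the pieces `𝔤±₁` are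
`𝔤₀̄`-submodules and `[𝔤₁,𝔤₁] = [𝔤₋₁,𝔤₋₁] = 0`.  The super skew-symmetry and the super
Jacobi identity are imposed on (parity-)homogeneous elements, as usual. -/
structure GLSA where
  carrier : Type
  [isACG : AddCommGroup carrier]
  [isMod : Module ℂ carrier]
  bracket : carrier →ₗ[ℂ] carrier →ₗ[ℂ] carrier
  gneg : Submodule ℂ carrier
  g0 : Submodule ℂ carrier
  gpos : Submodule ℂ carrier
  oddCompl : IsCompl g0 (gneg ⊔ gpos)
  disjNP : Disjoint gneg gpos
  br_00 : ∀ x ∈ g0, ∀ y ∈ g0, bracket x y ∈ g0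
  br_0p : ∀ x ∈ g0, ∀ y ∈ gpos, bracket x y ∈ gpos
  br_0n : ∀ x ∈ g0, ∀ y ∈ gneg, bracket x y ∈ gneg
  br_pn : ∀ x ∈ gpos, ∀ y ∈ gneg, bracket x y ∈ g0
  br_pp : ∀ x ∈ gpos, ∀ y ∈ gpos, bracket x y = 0
  br_nn : ∀ x ∈ gneg, ∀ y ∈ gneg, bracket x y = 0
  skew_e : ∀ x ∈ g0, ∀ y, bracket x y = - bracket y x
  skew_oo : ∀ x ∈ gneg ⊔ gpos, ∀ y ∈ gneg ⊔ gpos, bracket x y = bracket y x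
  jacobi_e : ∀ x y z : carrier, (x ∈ g0 ∨ y ∈ g0) →
    bracket x (bracket y z) = bracket (bracket x y) z + bracket y (bracket x z)
  jacobi_oo : ∀ x ∈ gneg ⊔ gpos, ∀ y ∈ gneg ⊔ gpos, ∀ z,
    bracket x (bracket y z) = bracket (bracket x y) z - bracket y (bracket x z)

attribute [instance] GLSA.isACG GLSA.isMod

/-- The odd part `𝔤₁̄ = 𝔤₋₁ ⊕ 𝔤₁` of `L`. -/
def GLSA.odd (L : GLSA) : Submodule ℂ L.carrier := L.gneg ⊔ L.gpos

/-- A `𝔤`-supermodule: a `ℤ₂`-graded complex vector space with a compatible action of the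
Lie superalgebra `L` (signs in the compatibility with the bracket are imposed on
homogeneous elements). -/
structure SMod (L : GLSA) where
  carrier : Type
  [isACG : AddCommGroup carrier]
  [isMod : Module ℂ carrier]
  act : L.carrier →ₗ[ℂ] carrier →ₗ[ℂ] carrier
  ev : Submodule ℂ carrier
  od : Submodule ℂ carrier
  grading : IsCompl ev od
  act_e_ev : ∀ x ∈ L.g0, ∀ m ∈ ev, act x m ∈ ev
  act_e_od : ∀ x ∈ L.g0, ∀ m ∈ od, act x m ∈ od
  act_o_ev : ∀ x ∈ L.odd, ∀ m ∈ ev, act x m ∈ od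
  act_o_od : ∀ x ∈ L.odd, ∀ m ∈ od, act x m ∈ ev
  act_br_e : ∀ x y : L.carrier, (x ∈ L.g0 ∨ y ∈ L.g0) → ∀ m,
    act (L.bracket x y) m = act x (act y m) - act y (act x m)
  act_br_oo : ∀ x ∈ L.odd, ∀ y ∈ L.odd, ∀ m,
    act (L.bracket x y) m = act x (act y m) + act y (act x m)

attribute [instance] SMod.isACG SMod.isMod

/-- A `𝔤₀̄`-supermodule: a `ℤ₂`-graded complex vector space with an action of the (purely
even) Lie algebra `𝔤₀̄ = 𝔤₀` preserving the grading. -/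
structure SMod0 (L : GLSA) where
  carrier : Type
  [isACG : AddCommGroup carrier]
  [isMod : Module ℂ carrier]
  act : ↥L.g0 →ₗ[ℂ] carrier →ₗ[ℂ] carrier
  ev : Submodule ℂ carrier
  od : Submodule ℂ carrier
  grading : IsCompl ev od
  act_ev : ∀ (x : L.g0), ∀ m ∈ ev, act x m ∈ ev
  act_od : ∀ (x : L.g0), ∀ m ∈ od, act x m ∈ od
  act_br : ∀ (x y : L.g0) (m : carrier),
    act ⟨L.bracket ↑x ↑y, L.br_00 ↑x x.2 ↑y y.2⟩ m = act x (act y m) - act y (act x m)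

attribute [instance] SMod0.isACG SMod0.isMod

/-- A homomorphism of `𝔤`-supermodules (homogeneous of degree zero). -/
structure SHom {L : GLSA} (M N : SMod L) where
  toLin : M.carrier →ₗ[ℂ] N.carrier
  map_ev : ∀ m ∈ M.ev, toLin m ∈ N.ev
  map_od : ∀ m ∈ M.od, toLin m ∈ N.od
  equivar : ∀ (x : L.carrier) (m : M.carrier), toLin (M.act x m) = N.act x (toLin m)

/-- Isomorphism of `𝔤`-supermodules. -/
def SIso {L : GLSA} (M N : SMod L) : Prop := ∃ f : SHom M N, Bijective f.toLin

/-- Isomorphism of `𝔤₀̄`-supermodules. -/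
def SIso0 {L : GLSA} (V W : SMod0 L) : Prop :=
  ∃ e : V.carrier ≃ₗ[ℂ] W.carrier,
    (∀ v ∈ V.ev, e v ∈ W.ev) ∧ (∀ v ∈ V.od, e v ∈ W.od) ∧
    (∀ (x : L.g0) (v : V.carrier), e (V.act x v) = W.act x (e v))

/-- Isomorphism of `𝔤`-supermodules up to parity change. -/
def SIsoUpToParity {L : GLSA} (M N : SMod L) : Prop :=
  ∃ e : M.carrier ≃ₗ[ℂ] N.carrier,
    (∀ (x : L.carrier) (m : M.carrier), e (M.act x m) = N.act x (e m)) ∧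
    (((∀ m ∈ M.ev, e m ∈ N.ev) ∧ (∀ m ∈ M.od, e m ∈ N.od)) ∨
     ((∀ m ∈ M.ev, e m ∈ N.od) ∧ (∀ m ∈ M.od, e m ∈ N.ev)))

namespace SMod

variable {L : GLSA}

/-- A (graded) sub-supermodule of a `𝔤`-supermodule. -/
def IsSubmod (M : SMod L) (N : Submodule ℂ M.carrier) : Prop :=
  (∀ (x : L.carrier), ∀ m ∈ N, M.act x m ∈ N) ∧ N ≤ (N ⊓ M.ev) ⊔ (N ⊓ M.od)

/-- A simple sub-supermodule. -/
def IsSimpleSub (M : SMod L) (N : Submodule ℂ M.carrier) : Prop :=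
  M.IsSubmod N ∧ N ≠ ⊥ ∧ ∀ N', M.IsSubmod N' → N' ≤ N → N' = ⊥ ∨ N' = N

/-- The socle: the sum of all simple sub-supermodules. -/
def socle (M : SMod L) : Submodule ℂ M.carrier := sSup {N | M.IsSimpleSub N}

/-- The sub-supermodule generated by a subspace, i.e. `U(𝔤)·S`. -/
def gen (M : SMod L) (S : Submodule ℂ M.carrier) : Submodule ℂ M.carrier :=
  sInf {N | M.IsSubmod N ∧ S ≤ N}

/-- Simplicity of a `𝔤`-supermodule. -/
def IsSimple (M : SMod L) : Prop :=
  (⊤ : Submodule ℂ M.carrier) ≠ ⊥ ∧ ∀ N, M.IsSubmod N → N = ⊥ ∨ N = ⊤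

/-- Indecomposability of a `𝔤`-supermodule. -/
def Indecomposable (M : SMod L) : Prop :=
  (⊤ : Submodule ℂ M.carrier) ≠ ⊥ ∧
  ∀ N₁ N₂, M.IsSubmod N₁ → M.IsSubmod N₂ → N₁ ⊓ N₂ = ⊥ → N₁ ⊔ N₂ = ⊤ →
    N₁ = ⊥ ∨ N₂ = ⊥

/-- The parity change functor `Π`. -/
def pshift (M : SMod L) : SMod L where
  carrier := M.carrier
  act := M.act
  ev := M.od
  od := M.ev
  grading := M.grading.symm
  act_e_ev := M.act_e_od
  act_e_od := M.act_e_ev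
  act_o_ev := M.act_o_od
  act_o_od := M.act_o_ev
  act_br_e := M.act_br_e
  act_br_oo := M.act_br_oo

/-- The space `M^{𝔤₁}` of `𝔤₁`-invariants. -/
def invPos (M : SMod L) : Submodule ℂ M.carrier where
  carrier := {m | ∀ x ∈ L.gpos, M.act x m = 0}
  add_mem' := by
    intro a b ha hb x hx
    rw [map_add, ha x hx, hb x hx, add_zero]
  zero_mem' := by intro x hx; simp
  smul_mem' := by
    intro c a ha x hx
    rw [map_smul, ha x hx, smul_zero]

/-- The space `M^{𝔤₋₁}` of `𝔤₋₁`-invariants. -/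
def invNeg (M : SMod L) : Submodule ℂ M.carrier where
  carrier := {m | ∀ x ∈ L.gneg, M.act x m = 0}
  add_mem' := by
    intro a b ha hb x hx
    rw [map_add, ha x hx, hb x hx, add_zero]
  zero_mem' := by intro x hx; simp
  smul_mem' := by
    intro c a ha x hx
    rw [map_smul, ha x hx, smul_zero]

/-- Iterated action of a list of elements of `𝔤`. -/
def actList (M : SMod L) : List L.carrier → M.carrier → M.carrier
  | [], m => m
  | x :: xs, m => M.act x (M.actList xs m)

end SMod

namespace SMod0

variable {L : GLSA}

/-- A (graded) sub-supermodule of a `𝔤₀̄`-supermodule. -/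
def IsSubmod (V : SMod0 L) (N : Submodule ℂ V.carrier) : Prop :=
  (∀ (x : L.g0), ∀ v ∈ N, V.act x v ∈ N) ∧ N ≤ (N ⊓ V.ev) ⊔ (N ⊓ V.od)

/-- Simplicity of a `𝔤₀̄`-supermodule. -/
def IsSimple (V : SMod0 L) : Prop :=
  (⊤ : Submodule ℂ V.carrier) ≠ ⊥ ∧ ∀ N, V.IsSubmod N → N = ⊥ ∨ N = ⊤

end SMod0

/-- `IsKac V K η` expresses that `K`, together with the (even, `𝔤₀̄`-equivariant) unit map
`η : V → K` whose image is annihilated by `𝔤₁`, is *the* Kac module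
`K(V) = Ind_{𝔤≥0}^{𝔤} V` of the `𝔤₀̄`-supermodule `V` (on which `𝔤₁` acts by zero), i.e.
satisfies the universal property `Hom_𝔤(K(V), M) = Hom_{𝔤₀̄}(V, M^{𝔤₁})`. -/
structure IsKac {L : GLSA} (V : SMod0 L) (K : SMod L) (η : V.carrier →ₗ[ℂ] K.carrier) : Prop where
  map_ev : ∀ v ∈ V.ev, η v ∈ K.ev
  map_od : ∀ v ∈ V.od, η v ∈ K.od
  equivar : ∀ (x : L.g0) (v : V.carrier), η (V.act x v) = K.act ↑x (η v)
  pos_zero : ∀ x ∈ L.gpos, ∀ v : V.carrier, K.act x (η v) = 0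
  injective : Injective η
  generates : K.gen (LinearMap.range η) = ⊤
  universal : ∀ (M : SMod L) (φ : V.carrier →ₗ[ℂ] M.carrier),
    (∀ v ∈ V.ev, φ v ∈ M.ev) → (∀ v ∈ V.od, φ v ∈ M.od) →
    (∀ (x : L.g0) (v : V.carrier), φ (V.act x v) = M.act ↑x (φ v)) →
    (∀ x ∈ L.gpos, ∀ v : V.carrier, M.act x (φ v) = 0) →
    ∃! Φ : SHom K M, ∀ v, Φ.toLin (η v) = φ v

/-- The opposite Kac module `K'(V) = Ind_{𝔤≤0}^{𝔤} V` (with `𝔤₋₁` acting by zero on `V`),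
described by its universal property. -/
structure IsKac' {L : GLSA} (V : SMod0 L) (K : SMod L) (η : V.carrier →ₗ[ℂ] K.carrier) : Prop where
  map_ev : ∀ v ∈ V.ev, η v ∈ K.ev
  map_od : ∀ v ∈ V.od, η v ∈ K.od
  equivar : ∀ (x : L.g0) (v : V.carrier), η (V.act x v) = K.act ↑x (η v)
  neg_zero : ∀ x ∈ L.gneg, ∀ v : V.carrier, K.act x (η v) = 0
  injective : Injective η
  generates : K.gen (LinearMap.range η) = ⊤
  universal : ∀ (M : SMod L) (φ : V.carrier →ₗ[ℂ] M.carrier),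
    (∀ v ∈ V.ev, φ v ∈ M.ev) → (∀ v ∈ V.od, φ v ∈ M.od) →
    (∀ (x : L.g0) (v : V.carrier), φ (V.act x v) = M.act ↑x (φ v)) →
    (∀ x ∈ L.gneg, ∀ v : V.carrier, M.act x (φ v) = 0) →
    ∃! Φ : SHom K M, ∀ v, Φ.toLin (η v) = φ v

/-- `IsCoindPos W C ε` expresses that `C`, together with the (even, `𝔤₀̄`-equivariant)
counit `ε : C → W` killing `𝔤₁·C`, is the coinduced module `Coind_{𝔤≥0}^{𝔤}(W)` of the
`𝔤₀̄`-supermodule `W` (with `𝔤₁` acting by zero), i.e. satisfies the universal property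
`Hom_𝔤(M, Coind(W)) = Hom_{𝔤≥0}(Res M, W)`. -/
structure IsCoindPos {L : GLSA} (W : SMod0 L) (C : SMod L) (ε : C.carrier →ₗ[ℂ] W.carrier) : Prop where
  map_ev : ∀ c ∈ C.ev, ε c ∈ W.ev
  map_od : ∀ c ∈ C.od, ε c ∈ W.od
  equivar : ∀ (x : L.g0) (c : C.carrier), ε (C.act ↑x c) = W.act x (ε c)
  pos_zero : ∀ x ∈ L.gpos, ∀ c : C.carrier, ε (C.act x c) = 0
  universal : ∀ (M : SMod L) (ψ : M.carrier →ₗ[ℂ] W.carrier),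
    (∀ m ∈ M.ev, ψ m ∈ W.ev) → (∀ m ∈ M.od, ψ m ∈ W.od) →
    (∀ (x : L.g0) (m : M.carrier), ψ (M.act ↑x m) = W.act x (ψ m)) →
    (∀ x ∈ L.gpos, ∀ m : M.carrier, ψ (M.act x m) = 0) →
    ∃! Φ : SHom M C, ∀ m, ε (Φ.toLin m) = ψ m

/-- `Coind_{𝔤≤0}^{𝔤}(W)`, by its universal property. -/
structure IsCoindNeg {L : GLSA} (W : SMod0 L) (C : SMod L) (ε : C.carrier →ₗ[ℂ] W.carrier) : Prop where
  map_ev : ∀ c ∈ C.ev, ε c ∈ W.ev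
  map_od : ∀ c ∈ C.od, ε c ∈ W.od
  equivar : ∀ (x : L.g0) (c : C.carrier), ε (C.act ↑x c) = W.act x (ε c)
  neg_zero : ∀ x ∈ L.gneg, ∀ c : C.carrier, ε (C.act x c) = 0
  universal : ∀ (M : SMod L) (ψ : M.carrier →ₗ[ℂ] W.carrier),
    (∀ m ∈ M.ev, ψ m ∈ W.ev) → (∀ m ∈ M.od, ψ m ∈ W.od) →
    (∀ (x : L.g0) (m : M.carrier), ψ (M.act ↑x m) = W.act x (ψ m)) →
    (∀ x ∈ L.gneg, ∀ m : M.carrier, ψ (M.act x m) = 0) →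
    ∃! Φ : SHom M C, ∀ m, ε (Φ.toLin m) = ψ m

/-- The subspace `Λ^max(𝔤₋₁) ⊗ V ⊆ K(V)`: the span of all elements obtained by acting on
`η(V)` with `dim 𝔤₋₁` many elements of `𝔤₋₁`. -/
def botPartNeg {L : GLSA} (V : SMod0 L) (K : SMod L) (η : V.carrier →ₗ[ℂ] K.carrier) :
    Submodule ℂ K.carrier :=
  Submodule.span ℂ {m | ∃ (xs : List L.carrier) (v : V.carrier),
    xs.length = finrank ℂ ↥L.gneg ∧ (∀ x ∈ xs, x ∈ L.gneg) ∧ m = K.actList xs (η v)}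

/-- The subspace `Λ^max(𝔤₁) ⊗ V ⊆ K'(V)`. -/
def botPartPos {L : GLSA} (V : SMod0 L) (K : SMod L) (η : V.carrier →ₗ[ℂ] K.carrier) :
    Submodule ℂ K.carrier :=
  Submodule.span ℂ {m | ∃ (xs : List L.carrier) (v : V.carrier),
    xs.length = finrank ℂ ↥L.gpos ∧ (∀ x ∈ xs, x ∈ L.gpos) ∧ m = K.actList xs (η v)}

/-- For `x ∈ 𝔤₀̄`, the operator `ad x` restricted to `𝔤₁`. -/
def adPos (L : GLSA) (x : L.g0) : ↥L.gpos →ₗ[ℂ] ↥L.gpos :=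
  (L.bracket ↑x).restrict (fun y hy => L.br_0p ↑x x.2 y hy)

/-- For `x ∈ 𝔤₀̄`, the operator `ad x` restricted to `𝔤₋₁`. -/
def adNeg (L : GLSA) (x : L.g0) : ↥L.gneg →ₗ[ℂ] ↥L.gneg :=
  (L.bracket ↑x).restrict (fun y hy => L.br_0n ↑x x.2 y hy)

/-- The character by which `𝔤₀̄` acts on the one-dimensional module `Λ^max(𝔤₁)`. -/
def traceCharPos (L : GLSA) (x : L.g0) : ℂ := LinearMap.trace ℂ ↥L.gpos (adPos L x)

/-- The character by which `𝔤₀̄` acts on the one-dimensional module `Λ^max(𝔤₋₁)`. -/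
def traceCharNeg (L : GLSA) (x : L.g0) : ℂ := LinearMap.trace ℂ ↥L.gneg (adNeg L x)

/-- `IsTwistBy V W χ swap` expresses that `W ≅ ℂ_χ ⊗ V` as `𝔤₀̄`-supermodules, where `ℂ_χ`
is the one-dimensional module with character `χ`, of odd parity iff `swap = true`.
Taking `χ` to be `traceCharPos`/`traceCharNeg` (resp. their negatives) and `swap` the parity
of `dim 𝔤±₁` expresses `W ≅ Λ^max(𝔤±₁) ⊗ V` (resp. `W ≅ Λ^max(𝔤±₁^*) ⊗ V`). -/
def IsTwistBy {L : GLSA} (V W : SMod0 L) (χ : ↥L.g0 → ℂ) (swap : Bool) : Prop :=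
  ∃ e : V.carrier ≃ₗ[ℂ] W.carrier,
    (∀ (x : L.g0) (v : V.carrier), W.act x (e v) = e (V.act x v) + χ x • e v) ∧
    (if swap then (∀ v ∈ V.ev, e v ∈ W.od) ∧ (∀ v ∈ V.od, e v ∈ W.ev)
     else (∀ v ∈ V.ev, e v ∈ W.ev) ∧ (∀ v ∈ V.od, e v ∈ W.od))

/-- Parity (as a `Bool`) of `dim 𝔤₁`. -/
def parPos (L : GLSA) : Bool := (finrank ℂ ↥L.gpos) % 2 == 1

/-- Parity (as a `Bool`) of `dim 𝔤₋₁`. -/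
def parNeg (L : GLSA) : Bool := (finrank ℂ ↥L.gneg) % 2 == 1


open scoped TensorProduct

namespace SMod

variable {L : GLSA}

/-! ### Graded subspaces -/

/-- A subspace is graded as soon as it contains the even components of its elements. -/
theorem graded_of_even_mem {E : Type*} [AddCommGroup E] [Module ℂ E] {ev od N : Submodule ℂ E}
    (hc : IsCompl ev od) (h : ∀ a ∈ ev, ∀ b ∈ od, a + b ∈ N → a ∈ N) :
    N ≤ (N ⊓ ev) ⊔ (N ⊓ od) := by
  intro m hm
  obtain ⟨a, ha, b, hb, rfl⟩ := Submodule.mem_sup.1 (hc.sup_eq_top ▸ Submodule.mem_top (x := m))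
  have haN := h a ha b hb hm
  exact Submodule.add_mem_sup ⟨haN, ha⟩ ⟨(N.add_mem_iff_right haN).1 hm, hb⟩

theorem eq_of_add_eq {E : Type*} [AddCommGroup E] [Module ℂ E] {ev od : Submodule ℂ E}
    (hc : IsCompl ev od) {a b c d : E} (ha : a ∈ ev) (hb : b ∈ od) (hcc : c ∈ ev) (hd : d ∈ od)
    (h : a + b = c + d) : a = c := by
  have h1 : a - c = d - b := by rw [sub_eq_sub_iff_add_eq_add, h, add_comm]
  have h2 : a - c = 0 := Submodule.disjoint_def.1 hc.disjoint _ (ev.sub_mem ha hcc)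
    (h1 ▸ od.sub_mem hd hb)
  exact sub_eq_zero.1 h2

theorem even_mem_of_graded {E : Type*} [AddCommGroup E] [Module ℂ E] {ev od N : Submodule ℂ E}
    (hc : IsCompl ev od) (h : N ≤ (N ⊓ ev) ⊔ (N ⊓ od)) {a b : E} (ha : a ∈ ev) (hb : b ∈ od)
    (hab : a + b ∈ N) : a ∈ N := by
  obtain ⟨c, hcc, d, hd, hcd⟩ := Submodule.mem_sup.1 (h hab)
  rw [eq_of_add_eq hc ha hb hcc.2 hd.2 hcd.symm]
  exact hcc.1

theorem exists_decomp (M : SMod L) (m : M.carrier) : ∃ a ∈ M.ev, ∃ b ∈ M.od, a + b = m :=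
  Submodule.mem_sup.1 (M.grading.sup_eq_top ▸ Submodule.mem_top)

theorem gneg_odd {x : L.carrier} (hx : x ∈ L.gneg) : x ∈ L.odd := Submodule.mem_sup_left hx

theorem gpos_odd {x : L.carrier} (hx : x ∈ L.gpos) : x ∈ L.odd := Submodule.mem_sup_right hx

/-- A subspace stable under the three homogeneous pieces of `L` is stable under `L`. -/
theorem stable_of_pieces (M : SMod L) {N P : Submodule ℂ M.carrier}
    (h0 : ∀ x ∈ L.g0, ∀ m ∈ N, M.act x m ∈ P) (hn : ∀ x ∈ L.gneg, ∀ m ∈ N, M.act x m ∈ P)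
    (hp : ∀ x ∈ L.gpos, ∀ m ∈ N, M.act x m ∈ P) (x : L.carrier) (m : M.carrier) (hm : m ∈ N) :
    M.act x m ∈ P := by
  obtain ⟨a, ha, b, hb, rfl⟩ :=
    Submodule.mem_sup.1 (L.oddCompl.sup_eq_top ▸ Submodule.mem_top (x := x))
  obtain ⟨c, hc, d, hd, rfl⟩ := Submodule.mem_sup.1 hb
  simp only [map_add, LinearMap.add_apply]
  exact P.add_mem (h0 a ha m hm) (P.add_mem (hn c hc m hm) (hp d hd m hm))

/-! ### Invariants of `𝔤₁` and the image of `𝔤₋₁` -/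

theorem act_act_neg (M : SMod L) {x y : L.carrier} (hx : x ∈ L.gneg) (hy : y ∈ L.gneg)
    (m : M.carrier) : M.act x (M.act y m) = -M.act y (M.act x m) := by
  have h := M.act_br_oo x (gneg_odd hx) y (gneg_odd hy) m
  rw [L.br_nn x hx y hy, map_zero, LinearMap.zero_apply] at h
  exact eq_neg_of_add_eq_zero_left h.symm

theorem act_act_pos (M : SMod L) {x y : L.carrier} (hx : x ∈ L.gpos) (hy : y ∈ L.gpos)
    (m : M.carrier) : M.act x (M.act y m) = -M.act y (M.act x m) := by
  have h := M.act_br_oo x (gpos_odd hx) y (gpos_odd hy) m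
  rw [L.br_pp x hx y hy, map_zero, LinearMap.zero_apply] at h
  exact eq_neg_of_add_eq_zero_left h.symm

theorem eq_zero_of_eq_neg {E : Type*} [AddCommGroup E] [Module ℂ E] {a : E} (h : a = -a) :
    a = 0 := by
  have h2 : (2 : ℂ) • a = 0 := by rw [two_smul, ← eq_neg_iff_add_eq_zero, ← h]
  exact (smul_eq_zero.1 h2).resolve_left two_ne_zero

theorem act_act_even (M : SMod L) {y : L.carrier} (hy : y ∈ L.g0) (x : L.carrier)
    (m : M.carrier) : M.act y (M.act x m) = M.act (L.bracket y x) m + M.act x (M.act y m) := by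
  rw [M.act_br_e y x (Or.inl hy), sub_add_cancel]

theorem invPos_g0 (M : SMod L) {y : L.carrier} (hy : y ∈ L.g0) {m : M.carrier}
    (hm : m ∈ M.invPos) : M.act y m ∈ M.invPos := by
  intro x hx
  have h := M.act_act_even hy x m
  rw [hm x hx, hm _ (L.br_0p y hy x hx), map_zero, zero_add] at h
  exact h.symm

theorem invPos_graded (M : SMod L) :
    M.invPos ≤ (M.invPos ⊓ M.ev) ⊔ (M.invPos ⊓ M.od) := by
  refine graded_of_even_mem M.grading fun a ha b hb hab x hx => ?_
  have h := hab x hx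
  rw [map_add, add_comm] at h
  have h1 := eq_of_add_eq M.grading (M.act_o_od x (gpos_odd hx) b hb)
    (M.act_o_ev x (gpos_odd hx) a ha) M.ev.zero_mem M.od.zero_mem (h.trans (add_zero 0).symm)
  rwa [h1, zero_add] at h

/-- The subspace `𝔤₋₁·M`. -/
def negImage (M : SMod L) : Submodule ℂ M.carrier := Submodule.map₂ M.act L.gneg ⊤

theorem act_mem_negImage (M : SMod L) {x : L.carrier} (hx : x ∈ L.gneg) (m : M.carrier) :
    M.act x m ∈ M.negImage := Submodule.apply_mem_map₂ _ hx trivial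

theorem negImage_g0 (M : SMod L) {y : L.carrier} (hy : y ∈ L.g0) {m : M.carrier}
    (hm : m ∈ M.negImage) : M.act y m ∈ M.negImage := by
  have h : M.negImage ≤ M.negImage.comap (M.act y) := by
    refine Submodule.map₂_le.2 fun x hx n _ => ?_
    rw [Submodule.mem_comap, M.act_act_even hy]
    exact add_mem (M.act_mem_negImage (L.br_0n y hy x hx) n) (M.act_mem_negImage hx _)
  exact h hm

theorem negImage_graded (M : SMod L) :
    M.negImage ≤ (M.negImage ⊓ M.ev) ⊔ (M.negImage ⊓ M.od) := by
  refine Submodule.map₂_le.2 fun x hx n _ => ?_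
  obtain ⟨a, ha, b, hb, rfl⟩ := M.exists_decomp n
  rw [map_add, add_comm]
  exact Submodule.add_mem_sup ⟨M.act_mem_negImage hx b, M.act_o_od x (gneg_odd hx) b hb⟩
    ⟨M.act_mem_negImage hx a, M.act_o_ev x (gneg_odd hx) a ha⟩

/-- `𝔤₁` acts nilpotently, so a nonzero module has nonzero `𝔤₁`-invariants. -/
theorem invPos_ne_bot [FiniteDimensional ℂ ↥L.gpos] (M : SMod L)
    (hM : (⊤ : Submodule ℂ M.carrier) ≠ ⊥) : M.invPos ≠ ⊥ := by
  classical
  obtain ⟨m, -, hm⟩ := (Submodule.ne_bot_iff _).1 hM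
  obtain ⟨t, ht⟩ := (Submodule.fg_iff_finiteDimensional L.gpos).2 inferInstance
  have key : ∀ s : Finset L.carrier, (∀ x ∈ s, x ∈ L.gpos) →
      ∃ n : M.carrier, n ≠ 0 ∧ ∀ x ∈ s, M.act x n = 0 := by
    intro s
    induction s using Finset.induction_on with
    | empty => exact fun _ => ⟨m, hm, by simp⟩
    | insert x s _ ih =>
      intro hs
      obtain ⟨hx, hs⟩ := Finset.forall_mem_insert _ _ _ |>.1 hs
      obtain ⟨n, hn, hsn⟩ := ih hs
      by_cases hxn : M.act x n = 0
      · exact ⟨n, hn, Finset.forall_mem_insert _ _ _ |>.2 ⟨hxn, hsn⟩⟩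
      · refine ⟨_, hxn, Finset.forall_mem_insert _ _ _ |>.2 ⟨?_, fun y hy => ?_⟩⟩
        · exact eq_zero_of_eq_neg (M.act_act_pos hx hx n)
        · rw [M.act_act_pos (hs y hy) hx, hsn y hy, map_zero, neg_zero]
  obtain ⟨n, hn, htn⟩ := key t fun x hx => ht ▸ Submodule.subset_span hx
  refine (Submodule.ne_bot_iff _).2 ⟨n, fun x hx => ?_, hn⟩
  have hle : L.gpos ≤ LinearMap.ker (M.act.flip n) := by
    rw [← ht, Submodule.span_le]
    exact htn
  exact hle hx

/-- Nakayama's lemma for the nilpotent action of `𝔤₋₁`. -/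
theorem eq_top_of_sup_negImage [FiniteDimensional ℂ ↥L.gneg] (M : SMod L)
    {N : Submodule ℂ M.carrier} (hN : ∀ x ∈ L.gneg, ∀ m ∈ N, M.act x m ∈ N)
    (h : N ⊔ M.negImage = ⊤) : N = ⊤ := by
  classical
  by_contra hne
  obtain ⟨t, ht⟩ := (Submodule.fg_iff_finiteDimensional L.gneg).2 inferInstance
  have key : ∀ s : Finset L.carrier, (∀ x ∈ s, x ∈ L.gneg) →
      ∃ P : Submodule ℂ M.carrier, P ≠ ⊤ ∧ N ≤ P ∧
        (∀ x ∈ L.gneg, ∀ m ∈ P, M.act x m ∈ P) ∧ ∀ x ∈ s, ∀ m, M.act x m ∈ P := by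
    intro s
    induction s using Finset.induction_on with
    | empty => exact fun _ => ⟨N, hne, le_rfl, hN, by simp⟩
    | insert x s _ ih =>
      intro hs
      obtain ⟨hx, hs⟩ := Finset.forall_mem_insert _ _ _ |>.1 hs
      obtain ⟨P, hP, hNP, hst, hsP⟩ := ih hs
      refine ⟨P ⊔ LinearMap.range (M.act x), fun htop => hP ?_, hNP.trans le_sup_left, ?_,
        Finset.forall_mem_insert _ _ _ |>.2
          ⟨fun m => Submodule.mem_sup_right ⟨m, rfl⟩,
            fun y hy m => Submodule.mem_sup_left (hsP y hy m)⟩⟩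
      · have hxP : LinearMap.range (M.act x) ≤ P := by
          rintro _ ⟨m, rfl⟩
          obtain ⟨p, hp, _, ⟨n, rfl⟩, rfl⟩ :=
            Submodule.mem_sup.1 (htop ▸ Submodule.mem_top (x := m))
          rw [map_add, eq_zero_of_eq_neg (M.act_act_neg hx hx n), add_zero]
          exact hst x hx p hp
        rwa [sup_eq_left.2 hxP] at htop
      · intro y hy m hm
        obtain ⟨p, hp, _, ⟨n, rfl⟩, rfl⟩ := Submodule.mem_sup.1 hm
        rw [map_add, M.act_act_neg hy hx, ← map_neg]
        exact Submodule.add_mem_sup (hst y hy p hp) ⟨_, rfl⟩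
  obtain ⟨P, hP, hNP, -, htP⟩ := key t fun x hx => ht ▸ Submodule.subset_span hx
  refine hP (top_le_iff.1 (h ▸ sup_le hNP (Submodule.map₂_le.2 fun x hx m _ => ?_)))
  have hle : L.gneg ≤ P.comap (M.act.flip m) := by
    rw [← ht, Submodule.span_le]
    exact fun y hy => htP y hy m
  exact hle hx

/-- The submodule generated by a `𝔤₀`-submodule `N` of `M^{𝔤₁}` is `Λ(𝔤₋₁)·N`, hence is contained
in `N + 𝔤₋₁·M`. -/
theorem exists_isSubmod_le_sup_negImage (M : SMod L) {N : Submodule ℂ M.carrier}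
    (h0 : ∀ x ∈ L.g0, ∀ m ∈ N, M.act x m ∈ N) (hgr : N ≤ (N ⊓ M.ev) ⊔ (N ⊓ M.od))
    (hN : N ≤ M.invPos) : ∃ P, M.IsSubmod P ∧ N ≤ P ∧ P ≤ N ⊔ M.negImage := by
  let C : Set (Submodule ℂ M.carrier) :=
    {P | N ≤ P ∧ ∀ x ∈ L.gneg, ∀ m ∈ P, M.act x m ∈ P}
  let P : Submodule ℂ M.carrier := sInf C
  have hNP : N ≤ P := le_sInf fun Q hQ => hQ.1
  have hneg : ∀ x ∈ L.gneg, ∀ m ∈ P, M.act x m ∈ P := fun x hx m hm =>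
    Submodule.mem_sInf.2 fun Q hQ => hQ.2 x hx m (Submodule.mem_sInf.1 hm Q hQ)
  have hind : ∀ Q : Submodule ℂ M.carrier, N ≤ Q →
      (∀ x ∈ L.gneg, ∀ m ∈ P, m ∈ Q → M.act x m ∈ Q) → P ≤ Q := fun Q hQ hst =>
    (sInf_le (show P ⊓ Q ∈ C from ⟨le_inf hNP hQ,
      fun x hx m hm => ⟨hneg x hx m hm.1, hst x hx m hm.1 hm.2⟩⟩)).trans inf_le_right
  have hzero : ∀ y ∈ L.g0, ∀ m ∈ P, M.act y m ∈ P := by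
    intro y hy
    refine hind (P.comap (M.act y)) (fun n hn => hNP (h0 y hy n hn)) fun x hx m hm hm' => ?_
    rw [Submodule.mem_comap, M.act_act_even hy]
    exact P.add_mem (hneg _ (L.br_0n y hy x hx) m hm) (hneg x hx _ hm')
  have hpos : ∀ y ∈ L.gpos, ∀ m ∈ P, M.act y m ∈ P := by
    intro y hy
    refine hind (P.comap (M.act y)) (fun n hn => ?_) fun x hx m hm hm' => ?_
    · rw [Submodule.mem_comap, hN hn y hy]
      exact P.zero_mem
    · rw [Submodule.mem_comap,
        eq_sub_of_add_eq (M.act_br_oo y (gpos_odd hy) x (gneg_odd hx) m).symm]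
      exact P.sub_mem (hzero _ (L.br_pn y hy x hx) m hm) (hneg x hx _ hm')
  refine ⟨P, ⟨M.stable_of_pieces hzero hneg hpos, hind _ ?_ fun x hx m _ hm => ?_⟩, hNP,
    hind _ le_sup_left fun x hx m _ _ => Submodule.mem_sup_right (M.act_mem_negImage hx m)⟩
  · exact hgr.trans (sup_le_sup (inf_le_inf_right _ hNP) (inf_le_inf_right _ hNP))
  · obtain ⟨a, ha, b, hb, rfl⟩ := Submodule.mem_sup.1 hm
    rw [map_add, add_comm]
    exact Submodule.add_mem_sup ⟨hneg x hx b hb.1, M.act_o_od x (gneg_odd hx) b hb.2⟩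
      ⟨hneg x hx a ha.1, M.act_o_ev x (gneg_odd hx) a ha.2⟩

/-- The `𝔤₁`-invariants of a simple `𝔤`-supermodule form a simple `𝔤₀`-supermodule. -/
theorem IsSimple.eq_invPos [FiniteDimensional ℂ ↥L.gneg] {S : SMod L} (hS : S.IsSimple)
    {N : Submodule ℂ S.carrier} (h0 : ∀ x ∈ L.g0, ∀ m ∈ N, S.act x m ∈ N)
    (hgr : N ≤ (N ⊓ S.ev) ⊔ (N ⊓ S.od)) (hN : N ≤ S.invPos) (hne : N ≠ ⊥) : N = S.invPos := by
  have hprop : S.negImage ≠ ⊤ := fun h => hS.1 <| by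
    rw [S.eq_top_of_sup_negImage (N := ⊥) (by simp) (by rw [h, sup_top_eq])]
  have hdisj : S.invPos ⊓ S.negImage = ⊥ := by
    obtain ⟨P, hP, hJP, hle⟩ := S.exists_isSubmod_le_sup_negImage
      (N := S.invPos ⊓ S.negImage) (fun x hx m hm => ⟨S.invPos_g0 hx hm.1, S.negImage_g0 hx hm.2⟩)
      (graded_of_even_mem S.grading fun a ha b hb hab =>
        ⟨even_mem_of_graded S.grading S.invPos_graded ha hb hab.1,
          even_mem_of_graded S.grading S.negImage_graded ha hb hab.2⟩) inf_le_left
    rw [sup_eq_right.2 inf_le_right] at hle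
    rcases hS.2 P hP with rfl | rfl
    · exact le_bot_iff.1 hJP
    · exact absurd (top_le_iff.1 hle) hprop
  refine le_antisymm hN fun m hm => ?_
  obtain ⟨P, hP, hNP, hle⟩ := S.exists_isSubmod_le_sup_negImage h0 hgr hN
  rcases hS.2 P hP with rfl | rfl
  · exact absurd (le_bot_iff.1 hNP) hne
  obtain ⟨n, hn, g, hg, rfl⟩ := Submodule.mem_sup.1 (hle (Submodule.mem_top (x := m)))
  have hg0 : g ∈ S.invPos ⊓ S.negImage := ⟨(S.invPos.add_mem_iff_right (hN hn)).1 hm, hg⟩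
  rw [hdisj, Submodule.mem_bot] at hg0
  rwa [hg0, add_zero]

/-- The `𝔤₀`-supermodule `M^{𝔤₁}`. -/
def invPosModule (M : SMod L) : SMod0 L where
  carrier := M.invPos
  act :=
    { toFun := fun x => (M.act ↑x).restrict fun _ hm => M.invPos_g0 x.2 hm
      map_add' := fun x y => by ext m; simp [LinearMap.restrict_apply]
      map_smul' := fun c x => by ext m; simp [LinearMap.restrict_apply] }
  ev := M.ev.comap M.invPos.subtype
  od := M.od.comap M.invPos.subtype
  grading := by
    refine ⟨Submodule.disjoint_def.2 fun m he ho =>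
      Subtype.ext (Submodule.disjoint_def.1 M.grading.disjoint _ he ho),
      codisjoint_iff.2 (Submodule.eq_top_iff'.2 fun m => ?_)⟩
    obtain ⟨a, ha, b, hb, hab⟩ := Submodule.mem_sup.1 (M.invPos_graded m.2)
    exact Submodule.mem_sup.2 ⟨⟨a, ha.1⟩, ha.2, ⟨b, hb.1⟩, hb.2, Subtype.ext hab⟩
  act_ev := fun x m hm => M.act_e_ev x x.2 m hm
  act_od := fun x m hm => M.act_e_od x x.2 m hm
  act_br := fun x y m => Subtype.ext (M.act_br_e x y (Or.inl x.2) m)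

/-- The inclusion of `M^{𝔤₁}` into `M`. -/
def invPosIncl (M : SMod L) : M.invPosModule.carrier →ₗ[ℂ] M.carrier := M.invPos.subtype

/-! ### Quotients, kernels and ranges -/

/-- The quotient of a supermodule by a sub-supermodule. -/
def quotient (M : SMod L) (N : Submodule ℂ M.carrier) (hN : M.IsSubmod N) : SMod L where
  carrier := M.carrier ⧸ N
  act :=
    { toFun := fun x => N.mapQ N (M.act x) (hN.1 x)
      map_add' := fun x y => by ext m; simp
      map_smul' := fun c x => by ext m; simp }
  ev := M.ev.map N.mkQ
  od := M.od.map N.mkQ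
  grading := by
    refine ⟨Submodule.disjoint_def.2 ?_, codisjoint_iff.2 ?_⟩
    · rintro _ ⟨a, ha, rfl⟩ ⟨b, hb, hab⟩
      rw [Submodule.mkQ_apply, Submodule.Quotient.mk_eq_zero]
      refine even_mem_of_graded M.grading hN.2 ha (M.od.neg_mem hb) ?_
      rw [← sub_eq_add_neg]
      exact (Submodule.Quotient.eq N).1 hab.symm
    · rw [← Submodule.map_sup, M.grading.sup_eq_top, Submodule.map_top, Submodule.range_mkQ]
  act_e_ev := by
    rintro x hx _ ⟨m, hm, rfl⟩
    exact ⟨_, M.act_e_ev x hx m hm, rfl⟩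
  act_e_od := by
    rintro x hx _ ⟨m, hm, rfl⟩
    exact ⟨_, M.act_e_od x hx m hm, rfl⟩
  act_o_ev := by
    rintro x hx _ ⟨m, hm, rfl⟩
    exact ⟨_, M.act_o_ev x hx m hm, rfl⟩
  act_o_od := by
    rintro x hx _ ⟨m, hm, rfl⟩
    exact ⟨_, M.act_o_od x hx m hm, rfl⟩
  act_br_e := by
    intro x y h m
    obtain ⟨m, rfl⟩ := N.mkQ_surjective m
    exact congrArg N.mkQ (M.act_br_e x y h m)
  act_br_oo := by
    intro x hx y hy m
    obtain ⟨m, rfl⟩ := N.mkQ_surjective m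
    exact congrArg N.mkQ (M.act_br_oo x hx y hy m)

/-- The projection onto a quotient supermodule. -/
def quotientMap (M : SMod L) (N : Submodule ℂ M.carrier) (hN : M.IsSubmod N) :
    SHom M (M.quotient N hN) where
  toLin := N.mkQ
  map_ev := fun m hm => ⟨m, hm, rfl⟩
  map_od := fun m hm => ⟨m, hm, rfl⟩
  equivar := fun _ _ => rfl

end SMod

namespace SHom

variable {L : GLSA} {M N : SMod L}

theorem isSubmod_comap (f : SHom M N) {P : Submodule ℂ N.carrier} (hP : N.IsSubmod P) :
    M.IsSubmod (P.comap f.toLin) := by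
  refine ⟨fun x m hm => ?_, SMod.graded_of_even_mem M.grading fun a ha b hb hab => ?_⟩
  · rw [Submodule.mem_comap, f.equivar]
    exact hP.1 x _ hm
  · rw [Submodule.mem_comap, map_add] at hab
    exact SMod.even_mem_of_graded N.grading hP.2 (f.map_ev a ha) (f.map_od b hb) hab

theorem isSubmod_map (f : SHom M N) {P : Submodule ℂ M.carrier} (hP : M.IsSubmod P) :
    N.IsSubmod (P.map f.toLin) := by
  refine ⟨?_, ?_⟩
  · rintro x _ ⟨m, hm, rfl⟩
    exact ⟨_, hP.1 x m hm, f.equivar x m⟩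
  · rintro _ ⟨m, hm, rfl⟩
    obtain ⟨a, ha, b, hb, rfl⟩ := Submodule.mem_sup.1 (hP.2 hm)
    rw [map_add]
    exact Submodule.add_mem_sup ⟨⟨a, ha.1, rfl⟩, f.map_ev a ha.2⟩
      ⟨⟨b, hb.1, rfl⟩, f.map_od b hb.2⟩

theorem isSubmod_ker (f : SHom M N) : M.IsSubmod (LinearMap.ker f.toLin) :=
  f.isSubmod_comap ⟨by simp, bot_le⟩

/-- Two surjective homomorphisms with the same kernel have isomorphic targets. -/
theorem sIso_of_ker_eq {N' : SMod L} (f : SHom M N) (f' : SHom M N') (hf : Surjective f.toLin)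
    (hf' : Surjective f'.toLin) (h : LinearMap.ker f.toLin = LinearMap.ker f'.toLin) :
    SIso N N' := by
  let e : N.carrier ≃ₗ[ℂ] N'.carrier := (f.toLin.quotKerEquivOfSurjective hf).symm.trans
    ((Submodule.quotEquivOfEq _ _ h).trans (f'.toLin.quotKerEquivOfSurjective hf'))
  have he : ∀ m, e (f.toLin m) = f'.toLin m := fun m => by
    have : (f.toLin.quotKerEquivOfSurjective hf).symm (f.toLin m) = Submodule.Quotient.mk m := by
      rw [LinearEquiv.symm_apply_eq]; rfl
    simp only [e, LinearEquiv.trans_apply, this]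
    rfl
  refine ⟨⟨e.toLinearMap, fun n hn => ?_, fun n hn => ?_, fun x n => ?_⟩, e.bijective⟩
  · obtain ⟨m, rfl⟩ := hf n
    obtain ⟨a, ha, b, hb, rfl⟩ := M.exists_decomp m
    rw [map_add] at hn ⊢
    rw [SMod.eq_of_add_eq N.grading.symm (f.map_od b hb) (f.map_ev a ha) N.od.zero_mem hn
      (by rw [zero_add, add_comm]), add_zero]
    simpa [he] using f'.map_ev a ha
  · obtain ⟨m, rfl⟩ := hf n
    obtain ⟨a, ha, b, hb, rfl⟩ := M.exists_decomp m
    rw [map_add] at hn ⊢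
    rw [SMod.eq_of_add_eq N.grading (f.map_ev a ha) (f.map_od b hb) N.ev.zero_mem hn
      (by rw [zero_add]), zero_add]
    simpa [he] using f'.map_od b hb
  · obtain ⟨m, rfl⟩ := hf n
    simp [← f.equivar, he, ← f'.equivar]

/-- A nonzero homomorphism to a simple supermodule is surjective. -/
theorem surjective_of_isSimple (f : SHom M N) (hN : N.IsSimple) (hf : ∃ m, f.toLin m ≠ 0) :
    Surjective f.toLin := by
  rw [← LinearMap.range_eq_top, LinearMap.range_eq_map]
  refine (hN.2 _ (f.isSubmod_map ⟨fun _ _ _ => Submodule.mem_top, ?_⟩)).resolve_left fun h => ?_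
  · simp [M.grading.sup_eq_top]
  · obtain ⟨m, hm⟩ := hf
    exact hm ((Submodule.mem_bot ℂ).1 (h ▸ Submodule.mem_map_of_mem trivial))

end SHom

/-! ### Homomorphisms from a `𝔤₀`-supermodule to `𝔤₁`-invariants -/

/-- `φ` is an even homomorphism of `𝔤₀`-supermodules from `V` to `M^{𝔤₁}`. -/
structure IsInvHom {L : GLSA} (V : SMod0 L) (M : SMod L) (φ : V.carrier →ₗ[ℂ] M.carrier) :
    Prop where
  map_ev : ∀ v ∈ V.ev, φ v ∈ M.ev
  map_od : ∀ v ∈ V.od, φ v ∈ M.od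
  equivar : ∀ (x : L.g0) (v : V.carrier), φ (V.act x v) = M.act ↑x (φ v)
  pos_zero : ∀ x ∈ L.gpos, ∀ v : V.carrier, M.act x (φ v) = 0

namespace IsInvHom

variable {L : GLSA} {V V' : SMod0 L} {M N : SMod L} {φ : V.carrier →ₗ[ℂ] M.carrier}
  {φ' : V'.carrier →ₗ[ℂ] M.carrier}

theorem comp (h : IsInvHom V M φ) (f : SHom M N) : IsInvHom V N (f.toLin ∘ₗ φ) where
  map_ev v hv := f.map_ev _ (h.map_ev v hv)
  map_od v hv := f.map_od _ (h.map_od v hv)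
  equivar x v := by rw [LinearMap.comp_apply, h.equivar, f.equivar, LinearMap.comp_apply]
  pos_zero x hx v := by rw [LinearMap.comp_apply, ← f.equivar, h.pos_zero x hx, map_zero]

theorem isSubmod_comap (h : IsInvHom V M φ) {P : Submodule ℂ M.carrier}
    (h0 : ∀ x ∈ L.g0, ∀ m ∈ P, M.act x m ∈ P) (hgr : P ≤ (P ⊓ M.ev) ⊔ (P ⊓ M.od)) :
    V.IsSubmod (P.comap φ) := by
  refine ⟨fun x v hv => ?_, SMod.graded_of_even_mem V.grading fun a ha b hb hab => ?_⟩
  · rw [Submodule.mem_comap, h.equivar]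
    exact h0 x x.2 _ hv
  · rw [Submodule.mem_comap, map_add] at hab
    exact SMod.even_mem_of_graded M.grading hgr (h.map_ev a ha) (h.map_od b hb) hab

theorem injective (h : IsInvHom V M φ) (hV : V.IsSimple) (hφ : φ ≠ 0) : Injective φ := by
  rw [← LinearMap.ker_eq_bot]
  refine (hV.2 _ (h.isSubmod_comap (P := ⊥) (by simp) bot_le)).resolve_right fun htop => ?_
  exact hφ (LinearMap.ker_eq_top.1 htop)

theorem exists_decomp (V : SMod0 L) (v : V.carrier) : ∃ a ∈ V.ev, ∃ b ∈ V.od, a + b = v :=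
  Submodule.mem_sup.1 (V.grading.sup_eq_top ▸ Submodule.mem_top)

theorem range_g0 (h : IsInvHom V M φ) : ∀ x ∈ L.g0, ∀ m ∈ LinearMap.range φ,
    M.act x m ∈ LinearMap.range φ := by
  rintro x hx _ ⟨v, rfl⟩
  exact ⟨_, h.equivar ⟨x, hx⟩ v⟩

theorem range_graded (h : IsInvHom V M φ) :
    LinearMap.range φ ≤ (LinearMap.range φ ⊓ M.ev) ⊔ (LinearMap.range φ ⊓ M.od) := by
  rintro _ ⟨v, rfl⟩
  obtain ⟨a, ha, b, hb, rfl⟩ := exists_decomp V v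
  rw [map_add]
  exact Submodule.add_mem_sup ⟨⟨a, rfl⟩, h.map_ev a ha⟩ ⟨⟨b, rfl⟩, h.map_od b hb⟩

theorem range_le_invPos (h : IsInvHom V M φ) : LinearMap.range φ ≤ M.invPos := by
  rintro _ ⟨v, rfl⟩ x hx
  exact h.pos_zero x hx v

theorem range_eq_invPos [FiniteDimensional ℂ ↥L.gneg] (h : IsInvHom V M φ) (hM : M.IsSimple)
    (hφ : φ ≠ 0) : LinearMap.range φ = M.invPos :=
  hM.eq_invPos h.range_g0 h.range_graded h.range_le_invPos
    fun hbot => hφ (LinearMap.range_eq_bot.1 hbot)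

theorem mem_ev_of_injective (h : IsInvHom V M φ) (hφ : Injective φ) {v : V.carrier}
    (hv : φ v ∈ M.ev) : v ∈ V.ev := by
  obtain ⟨a, ha, b, hb, rfl⟩ := exists_decomp V v
  rw [map_add, add_comm] at hv
  have hb0 := SMod.eq_of_add_eq M.grading.symm (h.map_od b hb) (h.map_ev a ha) M.od.zero_mem hv
    (zero_add _).symm
  rwa [hφ (hb0.trans (map_zero φ).symm), add_zero]

theorem mem_od_of_injective (h : IsInvHom V M φ) (hφ : Injective φ) {v : V.carrier}
    (hv : φ v ∈ M.od) : v ∈ V.od := by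
  obtain ⟨a, ha, b, hb, rfl⟩ := exists_decomp V v
  rw [map_add] at hv
  have ha0 := SMod.eq_of_add_eq M.grading (h.map_ev a ha) (h.map_od b hb) M.ev.zero_mem hv
    (zero_add _).symm
  rwa [hφ (ha0.trans (map_zero φ).symm), zero_add]

/-- Two injective homomorphisms with the same range have isomorphic sources. -/
theorem sIso0_of_range_eq (h : IsInvHom V M φ) (h' : IsInvHom V' M φ') (hφ : Injective φ)
    (hφ' : Injective φ') (hr : LinearMap.range φ = LinearMap.range φ') : SIso0 V V' := by
  let e : V.carrier ≃ₗ[ℂ] V'.carrier := (LinearEquiv.ofInjective φ hφ).trans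
    ((LinearEquiv.ofEq _ _ hr).trans (LinearEquiv.ofInjective φ' hφ').symm)
  have he : ∀ v, φ' (e v) = φ v := fun v => by
    rw [← LinearEquiv.ofInjective_apply (h := hφ') φ' (e v)]
    simp [e]
  refine ⟨e, fun v hv => h'.mem_ev_of_injective hφ' ?_,
    fun v hv => h'.mem_od_of_injective hφ' ?_, fun x v => hφ' ?_⟩
  · rw [he]
    exact h.map_ev v hv
  · rw [he]
    exact h.map_od v hv
  · rw [he, h.equivar, h'.equivar, he]

end IsInvHom

namespace SMod

variable {L : GLSA}

theorem invPosIncl_injective (M : SMod L) : Injective M.invPosIncl := Subtype.val_injective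

theorem range_invPosIncl (M : SMod L) : LinearMap.range M.invPosIncl = M.invPos :=
  M.invPos.range_subtype

theorem isInvHom_invPosIncl (M : SMod L) : IsInvHom M.invPosModule M M.invPosIncl :=
  ⟨fun _ hv => hv, fun _ hv => hv, fun _ _ => rfl, fun x hx v => v.2 x hx⟩

theorem IsSimple.invPosModule [FiniteDimensional ℂ ↥L.gneg] [FiniteDimensional ℂ ↥L.gpos]
    {S : SMod L} (hS : S.IsSimple) : S.invPosModule.IsSimple := by
  have hinj := S.invPosIncl_injective
  have hι := S.isInvHom_invPosIncl
  refine ⟨fun h => S.invPos_ne_bot hS.1 ?_, fun N hN => or_iff_not_imp_left.2 fun hne => ?_⟩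
  · rw [← S.range_invPosIncl, LinearMap.range_eq_map, h, Submodule.map_bot]
  · refine Submodule.map_injective_of_injective hinj ?_
    rw [← LinearMap.range_eq_map, S.range_invPosIncl]
    refine hS.eq_invPos ?_ ?_ ?_ fun h => hne ?_
    · rintro x hx _ ⟨m, hm, rfl⟩
      exact ⟨_, hN.1 ⟨x, hx⟩ m hm, rfl⟩
    · rintro _ ⟨m, hm, rfl⟩
      obtain ⟨a, ha, b, hb, rfl⟩ := Submodule.mem_sup.1 (hN.2 hm)
      rw [map_add]
      exact Submodule.add_mem_sup ⟨⟨a, ha.1, rfl⟩, hι.map_ev a ha.2⟩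
        ⟨⟨b, hb.1, rfl⟩, hι.map_od b hb.2⟩
    · rw [← S.range_invPosIncl]
      exact LinearMap.map_le_range
    · exact Submodule.map_injective_of_injective hinj (h.trans (Submodule.map_bot _).symm)

end SMod

/-! ### Kac modules -/

namespace IsKac

variable {L : GLSA} {V : SMod0 L} {K : SMod L} {η : V.carrier →ₗ[ℂ] K.carrier}

theorem isInvHom (h : IsKac V K η) : IsInvHom V K η :=
  ⟨h.map_ev, h.map_od, h.equivar, h.pos_zero⟩

theorem eq_top (h : IsKac V K η) {P : Submodule ℂ K.carrier} (hP : K.IsSubmod P)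
    (hη : LinearMap.range η ≤ P) : P = ⊤ :=
  top_le_iff.1 (h.generates ▸ sInf_le ⟨hP, hη⟩)

theorem range_sup_negImage (h : IsKac V K η) : LinearMap.range η ⊔ K.negImage = ⊤ := by
  obtain ⟨P, hP, hle, hPle⟩ := K.exists_isSubmod_le_sup_negImage h.isInvHom.range_g0
    h.isInvHom.range_graded h.isInvHom.range_le_invPos
  exact top_le_iff.1 (h.eq_top hP hle ▸ hPle)

theorem top_ne_bot (h : IsKac V K η) (hV : V.IsSimple) : (⊤ : Submodule ℂ K.carrier) ≠ ⊥ := by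
  obtain ⟨v, -, hv⟩ := (Submodule.ne_bot_iff _).1 hV.1
  exact (Submodule.ne_bot_iff _).2 ⟨η v, trivial, fun h0 => hv (h.injective (by simpa using h0))⟩

/-- Proper submodules of a Kac module lie in `𝔤₋₁·K`. -/
theorem le_negImage [FiniteDimensional ℂ ↥L.gneg] (h : IsKac V K η) (hV : V.IsSimple)
    {N : Submodule ℂ K.carrier} (hN : K.IsSubmod N) (hne : N ≠ ⊤) : N ≤ K.negImage := by
  have hsub : V.IsSubmod ((N ⊔ K.negImage).comap η) := by
    refine h.isInvHom.isSubmod_comap (fun x hx m hm => ?_) (sup_le ?_ ?_)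
    · obtain ⟨n, hn, k, hk, rfl⟩ := Submodule.mem_sup.1 hm
      rw [map_add]
      exact Submodule.add_mem_sup (hN.1 x n hn) (K.negImage_g0 hx hk)
    · exact hN.2.trans (sup_le_sup (inf_le_inf_right _ le_sup_left)
        (inf_le_inf_right _ le_sup_left))
    · exact K.negImage_graded.trans (sup_le_sup (inf_le_inf_right _ le_sup_right)
        (inf_le_inf_right _ le_sup_right))
  rcases hV.2 _ hsub with hbot | htop
  · intro n hn
    obtain ⟨_, ⟨v, rfl⟩, k, hk, hvk⟩ :=
      Submodule.mem_sup.1 (h.range_sup_negImage ▸ Submodule.mem_top (x := n))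
    have hv : v ∈ (N ⊔ K.negImage).comap η := by
      rw [Submodule.mem_comap, eq_sub_of_add_eq hvk]
      exact sub_mem (Submodule.mem_sup_left hn) (Submodule.mem_sup_right hk)
    rw [hbot, Submodule.mem_bot] at hv
    rwa [← hvk, hv, map_zero, zero_add]
  · refine absurd (K.eq_top_of_sup_negImage (fun x _ => hN.1 x) (top_le_iff.1 ?_)) hne
    rw [← h.range_sup_negImage]
    refine sup_le ?_ le_sup_right
    rintro _ ⟨v, rfl⟩
    exact Submodule.mem_comap.1 (htop.ge Submodule.mem_top)

theorem exists_maximal [FiniteDimensional ℂ ↥L.gneg] (h : IsKac V K η) (hV : V.IsSimple) :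
    ∃ N : Submodule ℂ K.carrier, K.IsSubmod N ∧ N ≠ ⊤ ∧
      ∀ N', K.IsSubmod N' → N' ≠ ⊤ → N' ≤ N := by
  refine ⟨sSup {N | K.IsSubmod N ∧ N ≠ ⊤}, ⟨fun x => ?_, sSup_le fun N hN => ?_⟩, fun htop => ?_,
    fun N' h1 h2 => le_sSup ⟨h1, h2⟩⟩
  · have hle : sSup {N | K.IsSubmod N ∧ N ≠ ⊤} ≤
        (sSup {N | K.IsSubmod N ∧ N ≠ ⊤}).comap (K.act x) :=
      sSup_le fun N hN m hm => le_sSup (a := N) hN (hN.1.1 x m hm)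
    exact hle
  · exact hN.1.2.trans (sup_le_sup (inf_le_inf_right _ (le_sSup hN))
      (inf_le_inf_right _ (le_sSup hN)))
  · have hle : sSup {N | K.IsSubmod N ∧ N ≠ ⊤} ≤ K.negImage :=
      sSup_le fun N hN => h.le_negImage hV hN.1 hN.2
    rw [htop, top_le_iff] at hle
    refine h.top_ne_bot hV ?_
    rw [K.eq_top_of_sup_negImage (N := ⊥) (by simp) (by rw [hle, sup_top_eq])]

/-- The composition of the unit with a surjection onto a simple supermodule is nonzero. -/
theorem comp_ne_zero (h : IsKac V K η) {Q : SMod L} (π : SHom K Q) (hQ : Q.IsSimple)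
    (hπ : Surjective π.toLin) : π.toLin ∘ₗ η ≠ 0 := by
  intro h0
  have hker := h.eq_top π.isSubmod_ker (LinearMap.range_le_ker_iff.2 h0)
  refine hQ.1 ?_
  rw [← LinearMap.range_eq_top.2 hπ, LinearMap.ker_eq_top.1 hker, LinearMap.range_zero]

end IsKac

/-- The kernel of a surjection onto a simple supermodule is the largest proper submodule, whenever
the latter exists. -/
theorem SHom.ker_eq_of_isGreatest {L : GLSA} {K Q : SMod L} {N : Submodule ℂ K.carrier}
    (hN : K.IsSubmod N) (hne : N ≠ ⊤) (hmax : ∀ N', K.IsSubmod N' → N' ≠ ⊤ → N' ≤ N)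
    (π : SHom K Q) (hQ : Q.IsSimple) (hπ : Surjective π.toLin) : LinearMap.ker π.toLin = N := by
  have hle : LinearMap.ker π.toLin ≤ N := hmax _ π.isSubmod_ker fun htop => hQ.1 <| by
    rw [← LinearMap.range_eq_top.2 hπ, LinearMap.ker_eq_top.1 htop, LinearMap.range_zero]
  refine le_antisymm hle ?_
  rcases hQ.2 _ (π.isSubmod_map hN) with hbot | htop
  · exact LinearMap.le_ker_iff_map.2 hbot
  · refine absurd ?_ hne
    rw [← sup_eq_left.2 hle, ← Submodule.comap_map_eq, htop, Submodule.comap_top]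

/-- The quotient by the largest proper submodule is simple. -/
theorem SMod.quotient_isSimple {L : GLSA} {K : SMod L} {N : Submodule ℂ K.carrier}
    (hN : K.IsSubmod N) (hne : N ≠ ⊤) (hmax : ∀ N', K.IsSubmod N' → N' ≠ ⊤ → N' ≤ N) :
    (K.quotient N hN).IsSimple := by
  have hsurj : Surjective N.mkQ := N.mkQ_surjective
  refine ⟨fun h => hne ?_, fun P hP => or_iff_not_imp_right.2 fun hPne => ?_⟩
  · refine Submodule.eq_top_iff'.2 fun m => (Submodule.Quotient.mk_eq_zero N).1 ?_
    exact h.le (Submodule.mem_top (x := N.mkQ m))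
  · have hle : P.comap N.mkQ ≤ N := hmax _ ((K.quotientMap N hN).isSubmod_comap hP)
      fun htop => hPne ?_
    · refine le_bot_iff.1 fun p hp => ?_
      obtain ⟨m, rfl⟩ := hsurj p
      exact (Submodule.Quotient.mk_eq_zero N).2 (hle hp)
    · refine Submodule.eq_top_iff'.2 fun p => ?_
      obtain ⟨m, rfl⟩ := hsurj p
      exact htop.ge (Submodule.mem_top (x := m))

namespace SMod0

variable {L : GLSA} (V : SMod0 L)

/-- The tensor algebra of `L` acts on every `L`-supermodule. -/
def _root_.SMod.tensorRep (M : SMod L) : TensorAlgebra ℂ L.carrier →ₐ[ℂ] Module.End ℂ M.carrier :=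
  TensorAlgebra.lift ℂ M.act

/-- The free module over the tensor algebra of `L` generated by the space `V`. -/
abbrev Free : Type := TensorAlgebra ℂ L.carrier ⊗[ℂ] V.carrier

variable {V} in
/-- The extension of a linear map `φ : V → M` to the free module. -/
def freeLift {M : SMod L} (φ : V.carrier →ₗ[ℂ] M.carrier) : V.Free →ₗ[ℂ] M.carrier :=
  TensorProduct.lift (M.tensorRep.toLinearMap.compl₂ φ)

variable {V} in
theorem freeLift_smul {M : SMod L} (φ : V.carrier →ₗ[ℂ] M.carrier)
    (a : TensorAlgebra ℂ L.carrier) (t : V.Free) :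
    freeLift φ (a • t) = M.tensorRep a (freeLift φ t) := by
  induction t using TensorProduct.induction_on with
  | zero => simp
  | tmul b v => simp [freeLift, TensorProduct.smul_tmul']
  | add s t hs ht => rw [smul_add, map_add, hs, ht, map_add, map_add]

variable {V} in
theorem freeLift_ι_smul {M : SMod L} (φ : V.carrier →ₗ[ℂ] M.carrier) (x : L.carrier)
    (t : V.Free) : freeLift φ (TensorAlgebra.ι ℂ x • t) = M.act x (freeLift φ t) := by
  rw [freeLift_smul, SMod.tensorRep, TensorAlgebra.lift_ι_apply]

/-- The elements of the free module that vanish under every homomorphism from `V` to the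
`𝔤₁`-invariants of a supermodule. -/
def kacRel : Submodule ℂ V.Free where
  carrier := {t | ∀ (M : SMod L) (φ : V.carrier →ₗ[ℂ] M.carrier), IsInvHom V M φ →
    freeLift φ t = 0}
  add_mem' hs ht M φ h := by rw [map_add, hs M φ h, ht M φ h, add_zero]
  zero_mem' M φ h := map_zero _
  smul_mem' c t ht M φ h := by rw [map_smul, ht M φ h, smul_zero]

/-- The underlying space of the Kac module. -/
abbrev KacSpace : Type := V.Free ⧸ V.kacRel

/-- The action of `L` on the Kac module. -/
def kacAct : L.carrier →ₗ[ℂ] V.KacSpace →ₗ[ℂ] V.KacSpace where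
  toFun x := V.kacRel.mapQ V.kacRel (Algebra.lsmul ℂ ℂ V.Free (TensorAlgebra.ι ℂ x))
    fun t ht M φ h => by
      rw [Algebra.lsmul_coe, freeLift_ι_smul, ht M φ h, map_zero]
  map_add' x y := by
    refine Submodule.linearMap_qext _ (LinearMap.ext fun t => ?_)
    exact congrArg V.kacRel.mkQ (by simp)
  map_smul' c x := by
    refine Submodule.linearMap_qext _ (LinearMap.ext fun t => ?_)
    exact congrArg V.kacRel.mkQ (by simp)

/-- The unit map from `V` to its Kac module. -/
def kacUnit : V.carrier →ₗ[ℂ] V.KacSpace :=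
  V.kacRel.mkQ ∘ₗ TensorProduct.mk ℂ (TensorAlgebra ℂ L.carrier) V.carrier 1

variable {V} in
/-- The extension of a homomorphism `V → M^{𝔤₁}` to the Kac module. -/
def kacLift {M : SMod L} {φ : V.carrier →ₗ[ℂ] M.carrier} (h : IsInvHom V M φ) :
    V.KacSpace →ₗ[ℂ] M.carrier :=
  V.kacRel.liftQ (freeLift φ) fun _ ht => ht M φ h

variable {V} in
theorem kacLift_act {M : SMod L} {φ : V.carrier →ₗ[ℂ] M.carrier} (h : IsInvHom V M φ)
    (x : L.carrier) (k : V.KacSpace) : kacLift h (V.kacAct x k) = M.act x (kacLift h k) := by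
  obtain ⟨t, rfl⟩ := V.kacRel.mkQ_surjective k
  exact freeLift_ι_smul φ x t

variable {V} in
theorem kacLift_unit {M : SMod L} {φ : V.carrier →ₗ[ℂ] M.carrier} (h : IsInvHom V M φ)
    (v : V.carrier) : kacLift h (V.kacUnit v) = φ v := by
  simp [kacLift, kacUnit, freeLift]

variable {V} in
theorem kac_ext {k l : V.KacSpace} (h : ∀ (M : SMod L) (φ : V.carrier →ₗ[ℂ] M.carrier)
    (hφ : IsInvHom V M φ), kacLift hφ k = kacLift hφ l) : k = l := by
  obtain ⟨s, rfl⟩ := V.kacRel.mkQ_surjective k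
  obtain ⟨t, rfl⟩ := V.kacRel.mkQ_surjective l
  refine (Submodule.Quotient.eq _).2 fun M φ hφ => ?_
  rw [map_sub, sub_eq_zero]
  exact h M φ hφ

variable {V} in
/-- The Kac module is generated by the image of the unit. -/
theorem kac_eq_top {W : Submodule ℂ V.KacSpace} (hact : ∀ x, ∀ k ∈ W, V.kacAct x k ∈ W)
    (hunit : ∀ v, V.kacUnit v ∈ W) : W = ⊤ := by
  have key : ∀ (a : TensorAlgebra ℂ L.carrier) (t : V.Free), V.kacRel.mkQ t ∈ W →
      V.kacRel.mkQ (a • t) ∈ W := by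
    intro a
    induction a using TensorAlgebra.induction with
    | algebraMap r =>
      intro t ht
      rw [algebraMap_smul, map_smul]
      exact W.smul_mem r ht
    | ι x => exact fun t ht => hact x _ ht
    | mul a b ha hb =>
      intro t ht
      rw [mul_smul]
      exact ha _ (hb t ht)
    | add a b ha hb =>
      intro t ht
      rw [add_smul, map_add]
      exact W.add_mem (ha t ht) (hb t ht)
  refine Submodule.eq_top_iff'.2 fun k => ?_
  obtain ⟨t, rfl⟩ := V.kacRel.mkQ_surjective k
  induction t using TensorProduct.induction_on with
  | zero => simp
  | tmul a v =>
    have := key a (1 ⊗ₜ v) (hunit v)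
    rwa [TensorProduct.smul_tmul', smul_eq_mul, mul_one] at this
  | add s t hs ht => rw [map_add]; exact W.add_mem hs ht

/-- The even part of the Kac module. -/
def kacEv : Submodule ℂ V.KacSpace where
  carrier := {k | ∀ (M : SMod L) (φ : V.carrier →ₗ[ℂ] M.carrier) (h : IsInvHom V M φ),
    kacLift h k ∈ M.ev}
  add_mem' hs ht M φ h := by rw [map_add]; exact M.ev.add_mem (hs M φ h) (ht M φ h)
  zero_mem' M φ h := by rw [map_zero]; exact M.ev.zero_mem
  smul_mem' c t ht M φ h := by rw [map_smul]; exact M.ev.smul_mem c (ht M φ h)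

/-- The odd part of the Kac module. -/
def kacOd : Submodule ℂ V.KacSpace where
  carrier := {k | ∀ (M : SMod L) (φ : V.carrier →ₗ[ℂ] M.carrier) (h : IsInvHom V M φ),
    kacLift h k ∈ M.od}
  add_mem' hs ht M φ h := by rw [map_add]; exact M.od.add_mem (hs M φ h) (ht M φ h)
  zero_mem' M φ h := by rw [map_zero]; exact M.od.zero_mem
  smul_mem' c t ht M φ h := by rw [map_smul]; exact M.od.smul_mem c (ht M φ h)

variable {V} in
theorem kacUnit_ev {v : V.carrier} (hv : v ∈ V.ev) : V.kacUnit v ∈ V.kacEv := fun M φ h => by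
  rw [kacLift_unit]; exact h.map_ev v hv

variable {V} in
theorem kacUnit_od {v : V.carrier} (hv : v ∈ V.od) : V.kacUnit v ∈ V.kacOd := fun M φ h => by
  rw [kacLift_unit]; exact h.map_od v hv

theorem kacAct_e_ev : ∀ x ∈ L.g0, ∀ k ∈ V.kacEv, V.kacAct x k ∈ V.kacEv :=
  fun x hx k hk M φ h => by rw [kacLift_act]; exact M.act_e_ev x hx _ (hk M φ h)

theorem kacAct_e_od : ∀ x ∈ L.g0, ∀ k ∈ V.kacOd, V.kacAct x k ∈ V.kacOd :=
  fun x hx k hk M φ h => by rw [kacLift_act]; exact M.act_e_od x hx _ (hk M φ h)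

theorem kacAct_o_ev : ∀ x ∈ L.odd, ∀ k ∈ V.kacEv, V.kacAct x k ∈ V.kacOd :=
  fun x hx k hk M φ h => by rw [kacLift_act]; exact M.act_o_ev x hx _ (hk M φ h)

theorem kacAct_o_od : ∀ x ∈ L.odd, ∀ k ∈ V.kacOd, V.kacAct x k ∈ V.kacEv :=
  fun x hx k hk M φ h => by rw [kacLift_act]; exact M.act_o_od x hx _ (hk M φ h)

theorem kac_isCompl : IsCompl V.kacEv V.kacOd := by
  refine ⟨Submodule.disjoint_def.2 fun k he ho => kac_ext fun M φ h => ?_,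
    codisjoint_iff.2 (kac_eq_top (fun x k hk => ?_) fun v => ?_)⟩
  · rw [map_zero]
    exact Submodule.disjoint_def.1 M.grading.disjoint _ (he M φ h) (ho M φ h)
  · obtain ⟨a, ha, b, hb, rfl⟩ := Submodule.mem_sup.1 hk
    obtain ⟨y, hy, z, hz, rfl⟩ :=
      Submodule.mem_sup.1 (L.oddCompl.sup_eq_top ▸ Submodule.mem_top (x := x))
    rw [map_add V.kacAct, LinearMap.add_apply, map_add, map_add]
    refine add_mem (Submodule.add_mem_sup (V.kacAct_e_ev y hy a ha) (V.kacAct_e_od y hy b hb)) ?_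
    rw [add_comm]
    exact Submodule.add_mem_sup (V.kacAct_o_od z hz b hb) (V.kacAct_o_ev z hz a ha)
  · obtain ⟨a, ha, b, hb, rfl⟩ := IsInvHom.exists_decomp V v
    rw [map_add]
    exact Submodule.add_mem_sup (kacUnit_ev ha) (kacUnit_od hb)

/-- The Kac module of `V`. -/
def kac : SMod L where
  carrier := V.KacSpace
  act := V.kacAct
  ev := V.kacEv
  od := V.kacOd
  grading := V.kac_isCompl
  act_e_ev := V.kacAct_e_ev
  act_e_od := V.kacAct_e_od
  act_o_ev := V.kacAct_o_ev
  act_o_od := V.kacAct_o_od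
  act_br_e x y hxy k := kac_ext fun M φ h => by
    simp only [map_sub, kacLift_act, M.act_br_e x y hxy]
  act_br_oo x hx y hy k := kac_ext fun M φ h => by
    simp only [map_add, kacLift_act, M.act_br_oo x hx y hy]

/-- If `V` embeds into the `𝔤₁`-invariants of some supermodule, then `V.kac` is a Kac module
of `V`. -/
theorem isKac_kac {M : SMod L} {φ : V.carrier →ₗ[ℂ] M.carrier} (h : IsInvHom V M φ)
    (hφ : Injective φ) : IsKac V V.kac V.kacUnit where
  map_ev _ hv := kacUnit_ev hv
  map_od _ hv := kacUnit_od hv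
  equivar x v := kac_ext fun M φ h => by
    exact (kacLift_unit h _).trans ((h.equivar x v).trans
      ((kacLift_act h _ _).trans (congrArg _ (kacLift_unit h v))).symm)
  pos_zero x hx v := kac_ext fun M φ h => by
    exact (kacLift_act h _ _).trans ((congrArg _ (kacLift_unit h v)).trans
      ((h.pos_zero x hx v).trans (map_zero _).symm))
  injective v w hvw := hφ <|
    (kacLift_unit h v).symm.trans ((congrArg (kacLift h) hvw).trans (kacLift_unit h w))
  generates := by
    refine top_le_iff.1 (le_sInf fun N hN => top_le_iff.2 ?_)
    exact kac_eq_top (V := V) hN.1.1 fun v => hN.2 ⟨v, rfl⟩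
  universal N ψ h1 h2 h3 h4 := by
    have hψ : IsInvHom V N ψ := ⟨h1, h2, h3, h4⟩
    refine ⟨⟨kacLift hψ, fun k hk => hk N ψ hψ, fun k hk => hk N ψ hψ, kacLift_act hψ⟩,
      kacLift_unit hψ, ?_⟩
    rintro ⟨Φ, hev, hod, hΦ⟩ hη
    have htop : LinearMap.eqLocus Φ (kacLift hψ) = ⊤ := by
      refine kac_eq_top (V := V) (fun x k hk => ?_) fun v => ?_
      · exact (hΦ x k).trans ((congrArg (N.act x) hk).trans (kacLift_act hψ x k).symm)
      · exact (hη v).trans (kacLift_unit hψ v).symm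
    congr 1
    exact LinearMap.eqLocus_eq_top.1 htop

end SMod0

/-- Theorem A, part 1: For any simple `𝔤₀`-supermodule `V`, the Kac module
`K(V)` has a unique simple top `L(V)` (equivalently, a unique maximal submodule), and the
correspondence `V ↦ L(V)` induces a bijection between the set of isomorphism classes of
simple `𝔤₀̄`-supermodules and that of simple `𝔤`-supermodules. -/
theorem statement_10 (L : GLSA)
    [FiniteDimensional ℂ ↥L.gneg] [FiniteDimensional ℂ ↥L.gpos] :
    -- K(V) has a unique maximal submodule and hence a unique simple top L(V)
    (∀ V : SMod0 L, V.IsSimple →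
      ∀ (K : SMod L) (η : V.carrier →ₗ[ℂ] K.carrier), IsKac V K η →
        (∃ N : Submodule ℂ K.carrier, K.IsSubmod N ∧ N ≠ ⊤ ∧
          ∀ N', K.IsSubmod N' → N' ≠ ⊤ → N' ≤ N) ∧
        (∃ (Q : SMod L) (π : SHom K Q), Q.IsSimple ∧ Surjective π.toLin) ∧
        (∀ (Q Q' : SMod L) (π : SHom K Q) (π' : SHom K Q'),
          Q.IsSimple → Q'.IsSimple → Surjective π.toLin → Surjective π'.toLin →
          SIso Q Q')) ∧
    -- V ↦ L(V) is injective on isomorphism classes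
    (∀ (V V' : SMod0 L), V.IsSimple → V'.IsSimple →
      ∀ (K : SMod L) (η : V.carrier →ₗ[ℂ] K.carrier), IsKac V K η →
      ∀ (K' : SMod L) (η' : V'.carrier →ₗ[ℂ] K'.carrier), IsKac V' K' η' →
      ∀ (Q Q' : SMod L) (π : SHom K Q) (π' : SHom K' Q'),
        Q.IsSimple → Q'.IsSimple → Surjective π.toLin → Surjective π'.toLin →
        SIso Q Q' → SIso0 V V') ∧
    -- V ↦ L(V) is surjective onto isomorphism classes of simple 𝔤-supermodules
    (∀ S : SMod L, S.IsSimple →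
      ∃ V : SMod0 L, V.IsSimple ∧
        ∃ (K : SMod L) (η : V.carrier →ₗ[ℂ] K.carrier), IsKac V K η ∧
          ∃ π : SHom K S, Surjective π.toLin) := by
  refine ⟨fun V hV K η h => ?_, ?_, fun S hS => ?_⟩
  · obtain ⟨N, hN, hne, hmax⟩ := h.exists_maximal hV
    refine ⟨⟨N, hN, hne, hmax⟩, ⟨K.quotient N hN, K.quotientMap N hN,
      SMod.quotient_isSimple hN hne hmax, N.mkQ_surjective⟩, fun Q Q' π π' hQ hQ' hπ hπ' => ?_⟩
    exact π.sIso_of_ker_eq π' hπ hπ' ((π.ker_eq_of_isGreatest hN hne hmax hQ hπ).trans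
      (π'.ker_eq_of_isGreatest hN hne hmax hQ' hπ').symm)
  · rintro V V' hV hV' K η h K' η' h' Q Q' π π' hQ hQ' hπ hπ' ⟨f, hf⟩
    have hφ : IsInvHom V Q' (f.toLin ∘ₗ π.toLin ∘ₗ η) := (h.isInvHom.comp π).comp f
    have hφ' : IsInvHom V' Q' (π'.toLin ∘ₗ η') := h'.isInvHom.comp π'
    have hne' := h'.comp_ne_zero π' hQ' hπ'
    have hne : f.toLin ∘ₗ π.toLin ∘ₗ η ≠ 0 := fun h0 => h.comp_ne_zero π hQ hπ <|
      LinearMap.ext fun v => hf.1 (by simpa using LinearMap.congr_fun h0 v)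
    exact hφ.sIso0_of_range_eq hφ' (hφ.injective hV hne) (hφ'.injective hV' hne')
      ((hφ.range_eq_invPos hQ' hne).trans (hφ'.range_eq_invPos hQ' hne').symm)
  · have hinv := S.isInvHom_invPosIncl
    have hV := hS.invPosModule
    have hK := S.invPosModule.isKac_kac hinv S.invPosIncl_injective
    obtain ⟨π, hπ, -⟩ := hK.universal S S.invPosIncl hinv.map_ev hinv.map_od hinv.equivar
      hinv.pos_zero
    refine ⟨_, hV, _, _, hK, π, π.surjective_of_isSimple hS ?_⟩
    obtain ⟨v, -, hv⟩ := (Submodule.ne_bot_iff _).1 hV.1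
    exact ⟨_, (hπ v).trans_ne fun h0 => hv (S.invPosIncl_injective (h0.trans (map_zero _).symm))⟩
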